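/- Fix integers s ≥ 2 and p ≥ 1. There exists a constant C > 0 such that for every real ζ with 0 < ζ < ζ_c, |σ_p(ζ) − (s²·A_{s,p}²/p)·log(1/(1 − ζ²/ζ_c²))| ≤ C, where A_{s,p} = p·M^p/√(2π·s·(s-1)). In particular σ_p(ζ) diverges logarithmically as ζ ↑ ζ_c, with explicit leading coefficient s²·A_{s,p}²/p. -/

import Mathlib

/-- Raney number `R_{s,p}(n) = (p/(s·n+p))·C(s·n+p, n)` as a real number. -/
noncomputable def raney (s p n : ℕ) : ℝ :=
  (p : ℝ) / (s * n + p) * (Nat.choose (s * n + p) n : ℝ)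

/-- The analytic threshold `ζ_c = (s-1)^{s-1}/s^s`. -/
noncomputable def zetaC (s : ℕ) : ℝ := ((s : ℝ) - 1) ^ (s - 1) / (s : ℝ) ^ s

/-- `M = s/(s-1)`. -/
noncomputable def Mconst (s : ℕ) : ℝ := (s : ℝ) / ((s : ℝ) - 1)

/-- The amplitude `A_{s,p} = p·M^p/√(2π·s·(s-1))`. -/
noncomputable def Aconst (s p : ℕ) : ℝ :=
  (p : ℝ) * Mconst s ^ p / Real.sqrt (2 * Real.pi * (s : ℝ) * ((s : ℝ) - 1))

/-- `f m = L + O(1/m)`. -/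
def Appr (f : ℕ → ℝ) (L : ℝ) : Prop :=
  ∃ K : ℝ, 0 ≤ K ∧ ∀ m : ℕ, 1 ≤ m → |f m - L| ≤ K / m

lemma Appr.mul {f g : ℕ → ℝ} {L M : ℝ} (hf : Appr f L) (hg : Appr g M) :
    Appr (fun m => f m * g m) (L * M) := by
  obtain ⟨K, hK, hf⟩ := hf
  obtain ⟨J, hJ, hg⟩ := hg
  refine ⟨K * (|M| + J) + |L| * J, by positivity, fun m hm => ?_⟩
  have hm' : (1 : ℝ) ≤ m := by exact_mod_cast hm
  have h1 := hf m hm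
  have h2 := hg m hm
  have h3 : |g m| ≤ |M| + J := by
    have : |g m| ≤ |M| + |g m - M| := by
      have := abs_add_le M (g m - M)
      simpa using this
    have h4 : J / m ≤ J := div_le_self hJ hm'
    linarith
  have e : f m * g m - L * M = (f m - L) * g m + L * (g m - M) := by ring
  have e2 : (K * (|M| + J) + |L| * J) / m = K / m * (|M| + J) + |L| * (J / m) := by ring
  rw [e, e2]
  refine (abs_add_le _ _).trans ?_
  rw [abs_mul, abs_mul]
  gcongr

lemma Appr.const (c : ℝ) : Appr (fun _ => c) c :=
  ⟨0, le_rfl, fun m _ => by simp⟩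

lemma Appr.inv {f : ℕ → ℝ} {L : ℝ} (hL : 0 < L) (hf : Appr f L)
    (h : ∀ m : ℕ, 1 ≤ m → L ≤ f m) : Appr (fun m => (f m)⁻¹) L⁻¹ := by
  obtain ⟨K, hK, hf⟩ := hf
  refine ⟨K / (L * L), by positivity, fun m hm => ?_⟩
  have h1 := h m hm
  have h2 : 0 < f m := hL.trans_le h1
  have e : (f m)⁻¹ - L⁻¹ = -((f m - L) / (f m * L)) := by field_simp; ring
  have e2 : K / (L * L) / m = K / m / (L * L) := by ring
  rw [e, abs_neg, abs_div, abs_of_pos (mul_pos h2 hL), e2]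
  have := hf m hm
  have h4 : 0 ≤ K / m := by positivity
  gcongr

lemma Appr.comp {f : ℕ → ℝ} {L : ℝ} (hf : Appr f L) (k : ℕ) (hk : 1 ≤ k) :
    Appr (fun m => f (k * m)) L := by
  obtain ⟨K, hK, hf⟩ := hf
  refine ⟨K, hK, fun m hm => ?_⟩
  refine (hf (k * m) (Nat.mul_pos hk hm)).trans ?_
  have hm' : (1 : ℝ) ≤ m := by exact_mod_cast hm
  have hk' : (1 : ℝ) ≤ k := by exact_mod_cast hk
  push_cast
  gcongr
  nlinarith

lemma Appr.congr {f g : ℕ → ℝ} {L : ℝ} (hf : Appr f L)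
    (h : ∀ m : ℕ, 1 ≤ m → g m = f m) : Appr g L := by
  obtain ⟨K, hK, hf⟩ := hf
  exact ⟨K, hK, fun m hm => by rw [h m hm]; exact hf m hm⟩

open Filter Topology in
lemma log_stirling_le (n : ℕ) :
    Real.log (Stirling.stirlingSeq (n + 1)) - 1 / (12 * ((n : ℝ) + 1)) ≤
      Real.log (√Real.pi) := by
  let u : ℕ → ℝ := fun k =>
    Real.log (Stirling.stirlingSeq (k + 1)) - 1 / (12 * ((k : ℝ) + 1))
  have hmono : Monotone u := by
    refine monotone_nat_of_le_succ fun k => ?_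
    have h := Stirling.log_stirlingSeq_sdiff_le (k + 1)
    have e : (1 : ℝ) / (12 * ((k : ℝ) + 1)) - 1 / (12 * (((k + 1 : ℕ) : ℝ) + 1))
      = 1 / (12 * ((k : ℝ) + 1) * ((k : ℝ) + 2)) := by
      push_cast
      field_simp
      ring
    simp only [u]
    have h' : Real.log (Stirling.stirlingSeq (k + 1)) - Real.log (Stirling.stirlingSeq (k + 1 + 1))
      ≤ 1 / (12 * ((k : ℝ) + 1) * ((k : ℝ) + 2)) := by
      refine h.trans (le_of_eq ?_)
      push_cast
      field_simp
      try ring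
    linarith
  have ht : Tendsto u atTop (𝓝 (Real.log (√Real.pi) - 0)) := by
    refine Tendsto.sub ?_ ?_
    · have h1 := Stirling.tendsto_stirlingSeq_sqrt_pi.comp (tendsto_add_atTop_nat 1)
      exact h1.log (by positivity)
    · have h2 := (tendsto_one_div_add_atTop_nhds_zero_nat (𝕜 := ℝ)).const_mul (1 / 12)
      rw [mul_zero] at h2
      refine h2.congr fun k => ?_
      field_simp
  rw [sub_zero] at ht
  exact hmono.ge_of_tendsto ht n

lemma appr_stirling : Appr Stirling.stirlingSeq (√Real.pi) := by
  refine ⟨√Real.pi, by positivity, fun m hm => ?_⟩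
  obtain ⟨n, rfl⟩ : ∃ n, m = n + 1 := ⟨m - 1, by omega⟩
  have h1 := Stirling.sqrt_pi_le_stirlingSeq (n := n + 1) (by omega)
  have h2 := log_stirling_le n
  have hpi : 0 < √Real.pi := by positivity
  have hpos := Stirling.stirlingSeq'_pos n
  rw [abs_of_nonneg (by linarith)]
  set x : ℝ := 1 / (12 * ((n : ℝ) + 1)) with hx
  have hx0 : 0 ≤ x := by positivity
  have hx1 : x ≤ 1 := by
    rw [hx, div_le_one (by positivity)]
    have : (0 : ℝ) ≤ n := by positivity
    linarith
  have h3 : Stirling.stirlingSeq (n + 1) ≤ √Real.pi * Real.exp x := by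
    rw [← Real.log_le_log_iff hpos (by positivity), Real.log_mul hpi.ne' (Real.exp_pos _).ne',
      Real.log_exp]
    linarith
  have h4 := Real.abs_exp_sub_one_le (x := x) (by rwa [abs_of_nonneg hx0])
  rw [abs_of_nonneg hx0] at h4
  have h5 := (le_abs_self _).trans h4
  have h6 : 2 * x ≤ 1 / ((n : ℝ) + 1) := by
    rw [hx]
    have : (0 : ℝ) < 1 / ((n : ℝ) + 1) := by positivity
    have e : 2 * (1 / (12 * ((n : ℝ) + 1))) = (1 / 6) * (1 / ((n : ℝ) + 1)) := by
      field_simp; norm_num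
    rw [e]; linarith
  have h7 : √Real.pi * (Real.exp x - 1) ≤ √Real.pi * (1 / ((n : ℝ) + 1)) := by
    gcongr; linarith
  push_cast
  rw [mul_one_div] at h7
  linarith

lemma factorial_sq (k : ℕ) (hk : 1 ≤ k) : ((k.factorial : ℝ)) ^ 2 =
    Stirling.stirlingSeq k ^ 2 * (2 * k) * ((k : ℝ) ^ k / Real.exp 1 ^ k) ^ 2 := by
  have hk' : (0 : ℝ) < k := by exact_mod_cast hk
  have hs : √(2 * (k : ℝ)) ^ 2 = 2 * k := Real.sq_sqrt (by positivity)
  rw [Stirling.stirlingSeq, div_pow, mul_pow, hs, ← div_pow]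
  field_simp

lemma base_identity (t m : ℕ) (ht : 1 ≤ t) (hm : 1 ≤ m) :
    (m : ℝ) * (((((t + 1) * m).choose m : ℕ) : ℝ) * ((t : ℝ) ^ t / ((t : ℝ) + 1) ^ (t + 1)) ^ m) ^ 2
    = (Stirling.stirlingSeq ((t + 1) * m) * Stirling.stirlingSeq ((t + 1) * m)) *
      (((Stirling.stirlingSeq m)⁻¹ * (Stirling.stirlingSeq m)⁻¹) *
      ((Stirling.stirlingSeq (t * m))⁻¹ * (Stirling.stirlingSeq (t * m))⁻¹)) *
      (((t : ℝ) + 1) / (2 * t)) := by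
  have htm : 1 ≤ t * m := Nat.mul_pos ht hm
  have hm' : (0 : ℝ) < m := by exact_mod_cast hm
  have ht' : (0 : ℝ) < t := by exact_mod_cast ht
  have hn : (t + 1) * m = t * m + m := by ring
  have hC : ((((t + 1) * m).choose m : ℕ) : ℝ) * ((t * m).factorial : ℝ) * (m.factorial : ℝ)
      = (((t + 1) * m).factorial : ℝ) := by
    rw [hn]; exact_mod_cast Nat.add_choose_mul_factorial_mul_factorial (t * m) m
  have f1 := factorial_sq ((t + 1) * m) (by rw [hn]; omega)
  have f2 := factorial_sq (t * m) htm
  have f3 := factorial_sq m hm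
  have hpos : ∀ k : ℕ, 1 ≤ k → 0 < Stirling.stirlingSeq k := by
    intro k hk
    obtain ⟨n, rfl⟩ : ∃ n, k = n + 1 := ⟨k - 1, by omega⟩
    exact Stirling.stirlingSeq'_pos n
  have p1 := hpos ((t + 1) * m) (by rw [hn]; omega)
  have p2 := hpos (t * m) htm
  have p3 := hpos m hm
  rw [← hC, mul_pow, mul_pow, f2, f3] at f1
  push_cast at f1
  rw [mul_pow ((t : ℝ) + 1) (m : ℝ), mul_pow (t : ℝ) (m : ℝ), pow_mul ((t : ℝ) + 1), pow_mul (t : ℝ),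
    mul_comm (t + 1) m, mul_comm t m, pow_mul (m : ℝ), pow_mul (m : ℝ), pow_mul (Real.exp 1),
    pow_mul (Real.exp 1)] at f1
  rw [div_pow]
  rw [mul_comm (t + 1) m, mul_comm t m] at *
  have hP : 0 < (((t : ℝ) + 1) ^ (t + 1)) ^ m := by positivity
  have hQ : 0 < ((t : ℝ) ^ t) ^ m := by positivity
  have hX : 0 < (m : ℝ) ^ m := by positivity
  have hE : 0 < Real.exp 1 ^ m := by positivity
  generalize (((t : ℝ) + 1) ^ (t + 1)) ^ m = P at *
  generalize ((t : ℝ) ^ t) ^ m = Q at *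
  generalize (m : ℝ) ^ m = X at *
  generalize Real.exp 1 ^ m = E at *
  generalize Stirling.stirlingSeq (m * (t + 1)) = S1 at *
  generalize Stirling.stirlingSeq (m * t) = S2 at *
  generalize Stirling.stirlingSeq m = S3 at *
  generalize (((m * (t + 1)).choose m : ℕ) : ℝ) = B at *
  rw [pow_succ X, pow_succ E] at f1
  have hXt : 0 < X ^ t := by positivity
  have hEt : 0 < E ^ t := by positivity
  generalize X ^ t = Y at *
  generalize E ^ t = F at *
  field_simp at f1 ⊢
  linear_combination f1

lemma appr_choose (t : ℕ) (ht : 1 ≤ t) (p : ℕ) :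
    Appr (fun m => (m : ℝ) * (((((t + 1) * m + p).choose m : ℕ) : ℝ) *
      ((t : ℝ) ^ t / ((t : ℝ) + 1) ^ (t + 1)) ^ m) ^ 2)
      (((t : ℝ) + 1) / (2 * Real.pi * t) * ((((t : ℝ) + 1) / t) ^ p) ^ 2) := by
  have ht' : (0 : ℝ) < t := by exact_mod_cast ht
  induction p with
  | zero =>
    have a1 := appr_stirling
    have a2 := Appr.inv (by positivity) a1
      (fun m hm => Stirling.sqrt_pi_le_stirlingSeq (n := m) (by omega))
    have b1 := a1.comp (t + 1) (by omega)
    have b2 := a2.comp t ht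
    have h := ((b1.mul b1).mul ((a2.mul a2).mul (b2.mul b2))).mul
      (Appr.const (((t : ℝ) + 1) / (2 * t)))
    have h' := h.congr (fun m hm => base_identity t m ht hm)
    simp only [add_zero]
    convert h' using 1
    have hpi : √Real.pi * √Real.pi = Real.pi := Real.mul_self_sqrt Real.pi_pos.le
    have hpi2 : (√Real.pi)⁻¹ * (√Real.pi)⁻¹ = Real.pi⁻¹ := by rw [← mul_inv, hpi]
    have := Real.pi_pos
    rw [hpi, hpi2]
    field_simp
    try simp
  | succ p ih =>
    have hr : Appr (fun m : ℕ => (((t : ℝ) + 1) * m + (p + 1)) / (t * m + (p + 1)))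
        (((t : ℝ) + 1) / t) := by
      refine ⟨((p : ℝ) + 1) / (t * t), by positivity, fun m hm => ?_⟩
      have hm' : (0 : ℝ) < m := by exact_mod_cast hm
      have e : (((t : ℝ) + 1) * m + (p + 1)) / (t * m + (p + 1)) - ((t : ℝ) + 1) / t
          = -(((p : ℝ) + 1) / (t * (t * m + (p + 1)))) := by
        field_simp
        ring
      rw [e, abs_neg, abs_of_nonneg (by positivity), div_div]
      have : (t : ℝ) * t * m ≤ t * (t * m + (p + 1)) := by
        have : 0 ≤ (t : ℝ) * (p + 1) := by positivity
        nlinarith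
      gcongr
    have h := (ih.mul (hr.mul hr)).congr (g := fun m => (m : ℝ) *
      (((((t + 1) * m + (p + 1)).choose m : ℕ) : ℝ) *
      ((t : ℝ) ^ t / ((t : ℝ) + 1) ^ (t + 1)) ^ m) ^ 2) (fun m hm => ?_)
    · convert h using 1
      rw [pow_succ]; ring
    · have hc := Nat.choose_mul_succ_eq ((t + 1) * m + p) m
      have e : (t + 1) * m + p + 1 - m = t * m + (p + 1) := by
        have : (t + 1) * m = t * m + m := by ring
        omega
      rw [e] at hc
      have hc' : ((((t + 1) * m + p).choose m : ℕ) : ℝ) * (((t : ℝ) + 1) * m + (p + 1))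
        = ((((t + 1) * m + (p + 1)).choose m : ℕ) : ℝ) * (t * m + (p + 1)) := by
        have := congrArg (Nat.cast (R := ℝ)) hc
        push_cast at this
        rw [← add_assoc ((t + 1) * m) p 1]
        linear_combination this
      have hd : (0 : ℝ) < t * m + (p + 1) := by positivity
      have hc2 := (eq_div_iff hd.ne').mpr hc'.symm
      rw [hc2]
      ring

lemma final_bound (g : ℕ → ℝ) (L : ℝ) (hg : Appr (fun m => (m : ℝ) * g m) L) :
    ∃ C : ℝ, 0 < C ∧ ∀ x : ℝ, 0 < x → x < 1 →
      |(∑' m : ℕ, g m * x ^ m) - L * Real.log (1 / (1 - x))| ≤ C := by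
  obtain ⟨K, hK, hg⟩ := hg
  have hb : Summable (fun m : ℕ => K / (((m + 1 : ℕ) : ℝ)) ^ 2) := by
    have h1 := (Real.summable_one_div_nat_pow (p := 2)).mpr (by norm_num)
    have h2 := ((summable_nat_add_iff 1).mpr h1).mul_left K
    simpa [div_eq_mul_inv] using h2
  have hS0 : 0 ≤ ∑' m : ℕ, K / (((m + 1 : ℕ) : ℝ)) ^ 2 := tsum_nonneg fun m => by positivity
  refine ⟨|g 0| + (∑' m : ℕ, K / (((m + 1 : ℕ) : ℝ)) ^ 2) + 1, by positivity, fun x hx0 hx1 => ?_⟩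
  have hlog := (Real.hasSum_pow_div_log_of_abs_lt_one (x := x)
    (by rwa [abs_of_pos hx0])).mul_left L
  have hd : ∀ m : ℕ, ‖(g (m + 1) * x ^ (m + 1) - L * (x ^ (m + 1) / ((m : ℝ) + 1)))‖
      ≤ K / (((m + 1 : ℕ) : ℝ)) ^ 2 := by
    intro m
    have h := hg (m + 1) (by omega)
    push_cast at h ⊢
    have hm : (0 : ℝ) < (m : ℝ) + 1 := by positivity
    have e : g (m + 1) * x ^ (m + 1) - L * (x ^ (m + 1) / ((m : ℝ) + 1))
        = (((m : ℝ) + 1) * g (m + 1) - L) / ((m : ℝ) + 1) * x ^ (m + 1) := by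
      field_simp
    rw [e, Real.norm_eq_abs, abs_mul, abs_div, abs_of_pos hm, abs_of_pos (pow_pos hx0 _)]
    have hx : x ^ (m + 1) ≤ 1 := pow_le_one₀ hx0.le hx1.le
    calc _ ≤ K / ((m : ℝ) + 1) / ((m : ℝ) + 1) * 1 := by gcongr
      _ = K / ((m : ℝ) + 1) ^ 2 := by field_simp
  have hds : Summable (fun m : ℕ =>
      (g (m + 1) * x ^ (m + 1) - L * (x ^ (m + 1) / ((m : ℝ) + 1)))) :=
    Summable.of_norm_bounded hb hd
  have hn := tsum_of_norm_bounded hb.hasSum hd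
  have hs1 : Summable (fun m : ℕ => g (m + 1) * x ^ (m + 1)) := by
    have := hds.add hlog.summable
    simpa using this
  have hs : Summable (fun m : ℕ => g m * x ^ m) := (summable_nat_add_iff 1).mp hs1
  rw [hs1.tsum_sub hlog.summable, hlog.tsum_eq, Real.norm_eq_abs] at hn
  rw [hs.tsum_eq_zero_add, one_div, Real.log_inv]
  have e : g 0 * x ^ 0 + ∑' m : ℕ, g (m + 1) * x ^ (m + 1) - L * -Real.log (1 - x)
    = g 0 + (∑' m : ℕ, g (m + 1) * x ^ (m + 1) - L * -Real.log (1 - x)) := by ring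
  rw [e]
  have := abs_add_le (g 0) (∑' m : ℕ, g (m + 1) * x ^ (m + 1) - L * -Real.log (1 - x))
  linarith

/-- Logarithmic divergence of the Gram weight: there is `C > 0` such that for
all `0 < ζ < ζ_c`,
`|σ_p(ζ) − (s²·A_{s,p}²/p)·log(1/(1 − ζ²/ζ_c²))| ≤ C`. -/
theorem stmt11 (s p : ℕ) (hs : 2 ≤ s) (hp : 1 ≤ p) :
    ∃ C : ℝ, 0 < C ∧ ∀ ζ : ℝ, 0 < ζ → ζ < zetaC s →
      |(∑' m : ℕ, (((p : ℝ) + m * s) ^ 2 / p) * raney s p m ^ 2 * ζ ^ (2 * m))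
          - ((s : ℝ) ^ 2 * Aconst s p ^ 2 / p) * Real.log (1 / (1 - ζ ^ 2 / zetaC s ^ 2))|
        ≤ C := by
  obtain ⟨t, rfl⟩ : ∃ t, s = t + 1 := ⟨s - 1, by omega⟩
  have ht : 1 ≤ t := by omega
  have ht' : (0 : ℝ) < t := by exact_mod_cast ht
  have hp' : (0 : ℝ) < p := by exact_mod_cast hp
  have hz : zetaC (t + 1) = (t : ℝ) ^ t / ((t : ℝ) + 1) ^ (t + 1) := by
    simp [zetaC]
  have hz0 : 0 < zetaC (t + 1) := by rw [hz]; positivity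
  have hA : (((t + 1 : ℕ) : ℝ)) ^ 2 * Aconst (t + 1) p ^ 2 / p
      = ((t : ℝ) + 1) / (2 * Real.pi * t) * ((((t : ℝ) + 1) / t) ^ p) ^ 2 * p := by
    have hpi := Real.pi_pos
    rw [Aconst, Mconst, div_pow, Real.sq_sqrt]
    · push_cast
      rw [add_sub_cancel_right]
      field_simp
    · push_cast
      rw [add_sub_cancel_right]
      positivity
  have h := ((appr_choose t ht p).mul (Appr.const (p : ℝ))).congr (g := fun m => (m : ℝ) *
    ((((((t + 1) * m + p).choose m : ℕ) : ℝ) * zetaC (t + 1) ^ m) ^ 2 * p))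
    (fun m _ => by rw [hz]; ring)
  obtain ⟨C, hC, hb⟩ := final_bound _ _ h
  refine ⟨C, hC, fun ζ h0 h1 => ?_⟩
  have hx := hb (ζ ^ 2 / zetaC (t + 1) ^ 2) (by positivity)
    (by rw [div_lt_one (by positivity)]; gcongr)
  rw [hA]
  convert hx using 5 with m
  have hd : (0 : ℝ) < ((t : ℝ) + 1) * m + p := by positivity
  rw [raney]
  push_cast
  rw [div_pow (ζ ^ 2), ← pow_mul ζ, ← pow_mul (zetaC (t + 1)), mul_pow _ (zetaC (t + 1) ^ m),
    ← pow_mul (zetaC (t + 1)), mul_comm m 2]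
  field_simp
  try ring
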